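/- Let θ ↦ π_θ be a parametrized policy family whose score function is bounded with constant Π_*, and let ε > 0. Then for all θ, θ_old ∈ ℝ^d, the largest absolute coordinate of ∇J(θ) − g_PPO^clip(θ, θ_old) is at most R · ‖θ − θ_old‖, where R := Π_*² R_* · ( 8Tγ/(1−γ)³ + (2T/(1−γ)) · (1 + 1/ε) ). -/

import Mathlib

/-- Value with `n` steps remaining. -/
noncomputable def valAux {S A : Type*} [Fintype S] [Fintype A]
    (γ : ℝ) (r : S → A → ℝ) (p : S → A → S → ℝ) (π : S → A → ℝ) : ℕ → S → ℝ
  | 0 => fun _ => 0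
  | n + 1 => fun s => ∑ a, π s a * (r s a + γ * ∑ s', p s a s' * valAux γ r p π n s')

/-- Finite-horizon value function `V_t^π` with horizon `T`. -/
noncomputable def Vval {S A : Type*} [Fintype S] [Fintype A]
    (γ : ℝ) (r : S → A → ℝ) (p : S → A → S → ℝ) (π : S → A → ℝ)
    (T t : ℕ) (s : S) : ℝ :=
  valAux γ r p π (T - t) s

/-- Finite-horizon state-action value `Q_t^π(s,a)`. -/
noncomputable def Qval {S A : Type*} [Fintype S] [Fintype A]
    (γ : ℝ) (r : S → A → ℝ) (p : S → A → S → ℝ) (π : S → A → ℝ)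
    (T t : ℕ) (s : S) (a : A) : ℝ :=
  r s a + γ * ∑ s', p s a s' * Vval γ r p π T (t + 1) s'

/-- Advantage `𝔸_t^π(s,a) = Q_t^π(s,a) - V_t^π(s)`. -/
noncomputable def Adv {S A : Type*} [Fintype S] [Fintype A]
    (γ : ℝ) (r : S → A → ℝ) (p : S → A → S → ℝ) (π : S → A → ℝ)
    (T t : ℕ) (s : S) (a : A) : ℝ :=
  Qval γ r p π T t s a - Vval γ r p π T t s

/-- State marginals `d_t^π`. -/
noncomputable def stateMarginal {S A : Type*} [Fintype S] [Fintype A]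
    (p : S → A → S → ℝ) (μ : S → ℝ) (π : S → A → ℝ) : ℕ → S → ℝ
  | 0 => μ
  | t + 1 => fun s => ∑ s', stateMarginal p μ π t s' * ∑ a, π s' a * p s' a s

/-- Clipped PPO surrogate gradient with clipping parameter `ε`. -/
noncomputable def gPPOclip {S A : Type*} [Fintype S] [Fintype A] {d : ℕ}
    (γ : ℝ) (r : S → A → ℝ) (p : S → A → S → ℝ) (μ : S → ℝ) (T : ℕ) (ε : ℝ)
    (π : EuclideanSpace ℝ (Fin d) → S → A → ℝ)
    (θ θold : EuclideanSpace ℝ (Fin d)) : EuclideanSpace ℝ (Fin d) :=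
  ∑ t ∈ Finset.range T, ∑ s, ∑ a,
    (γ ^ t * stateMarginal p μ (π θold) t s *
        (if |π θ s a / π θold s a - 1| ≤ ε then (1 : ℝ) else 0) *
        Adv γ r p (π θold) T t s a) •
      gradient (fun θ' => π θ' s a) θ

section

open Finset

section FiniteAverages

variable {ι M : Type*} [Fintype ι]

theorem abs_sum_mul_le_of_forall_abs_le {w x : ι → ℝ} {C : ℝ} (hw : ∀ i, 0 ≤ w i)
    (hw1 : ∑ i, w i = 1) (hx : ∀ i, |x i| ≤ C) : |∑ i, w i * x i| ≤ C :=
  calc |∑ i, w i * x i| ≤ ∑ i, |w i * x i| := abs_sum_le_sum_abs _ _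
    _ ≤ ∑ i, w i * C := sum_le_sum fun i _ => by
        rw [abs_mul, abs_of_nonneg (hw i)]
        exact mul_le_mul_of_nonneg_left (hx i) (hw i)
    _ = C := by rw [← sum_mul, hw1, one_mul]

variable [SeminormedAddCommGroup M] [NormedSpace ℝ M]

theorem norm_sum_smul_le_sum_abs_mul {w : ι → ℝ} {v : ι → M} {C : ℝ} (hv : ∀ i, ‖v i‖ ≤ C) :
    ‖∑ i, w i • v i‖ ≤ (∑ i, |w i|) * C := by
  rw [sum_mul]
  refine norm_sum_le_of_le _ fun i _ => ?_
  rw [norm_smul, Real.norm_eq_abs]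
  exact mul_le_mul_of_nonneg_left (hv i) (abs_nonneg _)

theorem norm_sum_smul_le_of_norm_le_mul {c q : ι → ℝ} {g : ι → M} {C G : ℝ}
    (hG : ∀ i, ‖g i‖ ≤ G * q i) (hq : ∑ i, q i = 1) (hc : ∀ i, |c i| ≤ C) :
    ‖∑ i, c i • g i‖ ≤ G * C :=
  calc ‖∑ i, c i • g i‖ ≤ ∑ i, C * (G * q i) := norm_sum_le_of_le _ fun i _ => by
        rw [norm_smul, Real.norm_eq_abs]
        exact mul_le_mul (hc i) (hG i) (norm_nonneg _) ((abs_nonneg _).trans (hc i))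
    _ = G * C := by rw [← mul_sum, ← mul_sum, hq]; ring

end FiniteAverages

theorem natCast_mul_pow_le_div_one_sub {γ : ℝ} (h0 : 0 ≤ γ) (h1 : γ < 1) (t : ℕ) :
    t * γ ^ t ≤ γ / (1 - γ) := by
  have key : ∀ k : ℕ, γ ^ k * (1 + k * (1 - γ)) ≤ 1 := by
    intro k
    induction k with
    | zero => simp
    | succ k ih =>
      refine le_trans ?_ ih
      rw [pow_succ, mul_assoc]
      refine mul_le_mul_of_nonneg_left ?_ (pow_nonneg h0 k)
      push_cast
      nlinarith [sq_nonneg (1 - γ), mul_nonneg (Nat.cast_nonneg (α := ℝ) k) (sq_nonneg (1 - γ))]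
  rw [le_div_iff₀ (sub_pos.2 h1)]
  cases t with
  | zero => simpa using h0
  | succ k =>
    have h2 : γ ^ k * ((k + 1) * (1 - γ)) ≤ 1 :=
      (mul_le_mul_of_nonneg_left (by linarith) (pow_nonneg h0 k)).trans (key k)
    calc ((k + 1 : ℕ) : ℝ) * γ ^ (k + 1) * (1 - γ) = γ * (γ ^ k * ((k + 1) * (1 - γ))) := by
          push_cast; ring
      _ ≤ γ := mul_le_of_le_one_right h0 h2

section Values

variable {S A : Type*} [Fintype S] {γ Rs : ℝ} {r : S → A → ℝ} {p : S → A → S → ℝ}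

theorem abs_actionValue_le (hγ0 : 0 ≤ γ) (hγ1 : γ < 1) (hr : ∀ s a, |r s a| ≤ Rs)
    (hp0 : ∀ s a s', 0 ≤ p s a s') (hp1 : ∀ s a, ∑ s', p s a s' = 1) {v : S → ℝ}
    (hv : ∀ s, |v s| ≤ Rs / (1 - γ)) (s : S) (a : A) :
    |r s a + γ * ∑ s', p s a s' * v s'| ≤ Rs / (1 - γ) := by
  have h1 : 0 < 1 - γ := sub_pos.2 hγ1
  have h2 := abs_sum_mul_le_of_forall_abs_le (hp0 s a) (hp1 s a) hv
  calc |r s a + γ * ∑ s', p s a s' * v s'| ≤ |r s a| + |γ * ∑ s', p s a s' * v s'| := abs_add_le _ _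
    _ ≤ Rs + γ * (Rs / (1 - γ)) := by
        rw [abs_mul, abs_of_nonneg hγ0]
        exact add_le_add (hr s a) (mul_le_mul_of_nonneg_left h2 hγ0)
    _ = Rs / (1 - γ) := by field_simp; ring

variable [Fintype A] {q q' : S → A → ℝ}

theorem abs_valAux_le (hγ0 : 0 ≤ γ) (hγ1 : γ < 1) (hRs : 0 ≤ Rs) (hr : ∀ s a, |r s a| ≤ Rs)
    (hp0 : ∀ s a s', 0 ≤ p s a s') (hp1 : ∀ s a, ∑ s', p s a s' = 1)
    (hq0 : ∀ s a, 0 ≤ q s a) (hq1 : ∀ s, ∑ a, q s a = 1) (n : ℕ) (s : S) :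
    |valAux γ r p q n s| ≤ Rs / (1 - γ) := by
  induction n generalizing s with
  | zero => simpa [valAux] using div_nonneg hRs (sub_nonneg.2 hγ1.le)
  | succ n ih =>
    exact abs_sum_mul_le_of_forall_abs_le (hq0 s) (hq1 s)
      (abs_actionValue_le hγ0 hγ1 hr hp0 hp1 ih s)

theorem abs_Qval_le (hγ0 : 0 ≤ γ) (hγ1 : γ < 1) (hRs : 0 ≤ Rs) (hr : ∀ s a, |r s a| ≤ Rs)
    (hp0 : ∀ s a s', 0 ≤ p s a s') (hp1 : ∀ s a, ∑ s', p s a s' = 1)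
    (hq0 : ∀ s a, 0 ≤ q s a) (hq1 : ∀ s, ∑ a, q s a = 1) (T t : ℕ) (s : S) (a : A) :
    |Qval γ r p q T t s a| ≤ Rs / (1 - γ) :=
  abs_actionValue_le hγ0 hγ1 hr hp0 hp1
    (fun s' => abs_valAux_le hγ0 hγ1 hRs hr hp0 hp1 hq0 hq1 _ s') s a

theorem abs_Adv_le (hγ0 : 0 ≤ γ) (hγ1 : γ < 1) (hRs : 0 ≤ Rs) (hr : ∀ s a, |r s a| ≤ Rs)
    (hp0 : ∀ s a s', 0 ≤ p s a s') (hp1 : ∀ s a, ∑ s', p s a s' = 1)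
    (hq0 : ∀ s a, 0 ≤ q s a) (hq1 : ∀ s, ∑ a, q s a = 1) (T t : ℕ) (s : S) (a : A) :
    |Adv γ r p q T t s a| ≤ 2 * (Rs / (1 - γ)) := by
  have hQ := abs_Qval_le hγ0 hγ1 hRs hr hp0 hp1 hq0 hq1 T t s a
  have hV := abs_valAux_le hγ0 hγ1 hRs hr hp0 hp1 hq0 hq1 (T - t) s
  exact (abs_sub _ _).trans ((add_le_add hQ hV).trans_eq (two_mul _).symm)

theorem abs_valAux_sub_le (hγ0 : 0 ≤ γ) (hγ1 : γ < 1) (hRs : 0 ≤ Rs) (hr : ∀ s a, |r s a| ≤ Rs)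
    (hp0 : ∀ s a s', 0 ≤ p s a s') (hp1 : ∀ s a, ∑ s', p s a s' = 1)
    (hq0 : ∀ s a, 0 ≤ q s a) (hq1 : ∀ s, ∑ a, q s a = 1)
    (hq0' : ∀ s a, 0 ≤ q' s a) (hq1' : ∀ s, ∑ a, q' s a = 1) {D : ℝ} (hD0 : 0 ≤ D)
    (hD : ∀ s, ∑ a, |q s a - q' s a| ≤ D) (n : ℕ) (s : S) :
    |valAux γ r p q n s - valAux γ r p q' n s| ≤ D * Rs / (1 - γ) ^ 2 := by
  have h1 : 0 < 1 - γ := sub_pos.2 hγ1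
  induction n generalizing s with
  | zero => simp only [valAux, sub_self, abs_zero]; positivity
  | succ n ih =>
    have e : valAux γ r p q (n + 1) s - valAux γ r p q' (n + 1) s
        = ∑ a, (q s a - q' s a) * (r s a + γ * ∑ s', p s a s' * valAux γ r p q n s')
          + ∑ a, q' s a * (γ * ∑ s', p s a s' * (valAux γ r p q n s' - valAux γ r p q' n s')) := by
      simp only [valAux, ← sum_sub_distrib, ← sum_add_distrib, mul_sub]
      exact sum_congr rfl fun a _ => by rw [sum_sub_distrib]; ring
    have b1 : |∑ a, (q s a - q' s a) * (r s a + γ * ∑ s', p s a s' * valAux γ r p q n s')|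
        ≤ D * (Rs / (1 - γ)) := by
      refine (norm_sum_smul_le_sum_abs_mul (M := ℝ) fun a => abs_actionValue_le hγ0 hγ1 hr hp0 hp1
        (abs_valAux_le hγ0 hγ1 hRs hr hp0 hp1 hq0 hq1 n) s a).trans ?_
      exact mul_le_mul_of_nonneg_right (hD s) (by positivity)
    have b2 : |∑ a, q' s a *
        (γ * ∑ s', p s a s' * (valAux γ r p q n s' - valAux γ r p q' n s'))|
        ≤ γ * (D * Rs / (1 - γ) ^ 2) := by
      refine abs_sum_mul_le_of_forall_abs_le (hq0' s) (hq1' s) fun a => ?_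
      rw [abs_mul, abs_of_nonneg hγ0]
      exact mul_le_mul_of_nonneg_left
        (abs_sum_mul_le_of_forall_abs_le (hp0 s a) (hp1 s a) ih) hγ0
    rw [e]
    calc _ ≤ D * (Rs / (1 - γ)) + γ * (D * Rs / (1 - γ) ^ 2) :=
          (abs_add_le _ _).trans (add_le_add b1 b2)
      _ = D * Rs / (1 - γ) ^ 2 := by field_simp; ring

theorem abs_Qval_sub_le (hγ0 : 0 ≤ γ) (hγ1 : γ < 1) (hRs : 0 ≤ Rs) (hr : ∀ s a, |r s a| ≤ Rs)
    (hp0 : ∀ s a s', 0 ≤ p s a s') (hp1 : ∀ s a, ∑ s', p s a s' = 1)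
    (hq0 : ∀ s a, 0 ≤ q s a) (hq1 : ∀ s, ∑ a, q s a = 1)
    (hq0' : ∀ s a, 0 ≤ q' s a) (hq1' : ∀ s, ∑ a, q' s a = 1) {D : ℝ} (hD0 : 0 ≤ D)
    (hD : ∀ s, ∑ a, |q s a - q' s a| ≤ D) (T t : ℕ) (s : S) (a : A) :
    |Qval γ r p q T t s a - Qval γ r p q' T t s a| ≤ γ * (D * Rs / (1 - γ) ^ 2) := by
  have e : Qval γ r p q T t s a - Qval γ r p q' T t s a = γ * ∑ s', p s a s' *
      (valAux γ r p q (T - (t + 1)) s' - valAux γ r p q' (T - (t + 1)) s') := by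
    simp only [Qval, Vval, mul_sub, sum_sub_distrib]; ring
  rw [e, abs_mul, abs_of_nonneg hγ0]
  exact mul_le_mul_of_nonneg_left (abs_sum_mul_le_of_forall_abs_le (hp0 s a) (hp1 s a)
    (abs_valAux_sub_le hγ0 hγ1 hRs hr hp0 hp1 hq0 hq1 hq0' hq1' hD0 hD _)) hγ0

end Values

section StateMarginals

variable {S A : Type*} [Fintype S] [Fintype A] {p : S → A → S → ℝ} {μ : S → ℝ} {q q' : S → A → ℝ}

theorem stateMarginal_nonneg (hp0 : ∀ s a s', 0 ≤ p s a s') (hμ0 : ∀ s, 0 ≤ μ s)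
    (hq0 : ∀ s a, 0 ≤ q s a) (t : ℕ) (s : S) : 0 ≤ stateMarginal p μ q t s := by
  induction t generalizing s with
  | zero => exact hμ0 s
  | succ t ih =>
    exact sum_nonneg fun s' _ => mul_nonneg (ih s') (sum_nonneg fun a _ =>
      mul_nonneg (hq0 s' a) (hp0 s' a s))

theorem sum_sum_mul_transition (hp1 : ∀ s a, ∑ s', p s a s' = 1) (c : A → ℝ) (s : S) :
    ∑ s', ∑ a, c a * p s a s' = ∑ a, c a := by
  rw [sum_comm]
  simp only [← mul_sum, hp1, mul_one]

theorem sum_stateMarginal (hp1 : ∀ s a, ∑ s', p s a s' = 1) (hμ1 : ∑ s, μ s = 1)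
    (hq1 : ∀ s, ∑ a, q s a = 1) (t : ℕ) : ∑ s, stateMarginal p μ q t s = 1 := by
  induction t with
  | zero => exact hμ1
  | succ t ih =>
    simp only [stateMarginal]
    rw [sum_comm]
    simp only [← mul_sum, sum_sum_mul_transition hp1, hq1, mul_one, ih]

theorem sum_abs_stateMarginal_sub_le (hp0 : ∀ s a s', 0 ≤ p s a s')
    (hp1 : ∀ s a, ∑ s', p s a s' = 1) (hμ0 : ∀ s, 0 ≤ μ s) (hμ1 : ∑ s, μ s = 1)
    (hq0 : ∀ s a, 0 ≤ q s a) (hq1 : ∀ s, ∑ a, q s a = 1)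
    (hq0' : ∀ s a, 0 ≤ q' s a) (hq1' : ∀ s, ∑ a, q' s a = 1) {D : ℝ}
    (hD : ∀ s, ∑ a, |q s a - q' s a| ≤ D) (t : ℕ) :
    ∑ s, |stateMarginal p μ q t s - stateMarginal p μ q' t s| ≤ t * D := by
  induction t with
  | zero => simp [stateMarginal]
  | succ t ih =>
    have hd' := stateMarginal_nonneg hp0 hμ0 hq0' t
    have step (s : S) : |stateMarginal p μ q (t + 1) s - stateMarginal p μ q' (t + 1) s|
        ≤ ∑ s', (|stateMarginal p μ q t s' - stateMarginal p μ q' t s'| * ∑ a, q s' a * p s' a s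
          + stateMarginal p μ q' t s' * ∑ a, |q s' a - q' s' a| * p s' a s) := by
      simp only [stateMarginal, ← sum_sub_distrib]
      refine (abs_sum_le_sum_abs _ _).trans (sum_le_sum fun s' _ => ?_)
      have e : stateMarginal p μ q t s' * ∑ a, q s' a * p s' a s
          - stateMarginal p μ q' t s' * ∑ a, q' s' a * p s' a s
          = (stateMarginal p μ q t s' - stateMarginal p μ q' t s') * ∑ a, q s' a * p s' a s
            + stateMarginal p μ q' t s' * ∑ a, (q s' a - q' s' a) * p s' a s := by
        simp only [sub_mul, sum_sub_distrib]; ring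
      rw [e]
      refine (abs_add_le _ _).trans (add_le_add ?_ ?_)
      · rw [abs_mul, abs_of_nonneg (a := ∑ a, q s' a * p s' a s)
          (sum_nonneg fun a _ => mul_nonneg (hq0 s' a) (hp0 s' a s))]
      · rw [abs_mul, abs_of_nonneg (hd' s')]
        refine mul_le_mul_of_nonneg_left ((abs_sum_le_sum_abs _ _).trans_eq ?_) (hd' s')
        exact sum_congr rfl fun a _ => by rw [abs_mul, abs_of_nonneg (hp0 s' a s)]
    refine (sum_le_sum fun s _ => step s).trans ?_
    rw [sum_comm]
    simp only [sum_add_distrib, ← mul_sum, sum_sum_mul_transition hp1, hq1, mul_one]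
    have h2 : ∑ s', stateMarginal p μ q' t s' * ∑ a, |q s' a - q' s' a| ≤ D :=
      (sum_le_sum fun s' _ => mul_le_mul_of_nonneg_left (hD s') (hd' s')).trans_eq (by
        rw [← sum_mul, sum_stateMarginal hp1 hμ1 hq1', one_mul])
    push_cast
    linarith

end StateMarginals

section PolicyGradient

variable {S A : Type*} [Fintype S] [Fintype A]

/-- Derivative of the value with `n` steps remaining, when `g s a` is the derivative of the policy
weight at `(s, a)`. -/
noncomputable def valAuxDeriv {M : Type*} [AddCommGroup M] [Module ℝ M]
    (γ : ℝ) (r : S → A → ℝ) (p : S → A → S → ℝ) (q : S → A → ℝ) (g : S → A → M) : ℕ → S → M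
  | 0 => fun _ => 0
  | n + 1 => fun s => ∑ a, (q s a • γ • ∑ s', p s a s' • valAuxDeriv γ r p q g n s'
      + (r s a + γ * ∑ s', p s a s' * valAux γ r p q n s') • g s a)

theorem hasFDerivAt_valAux {E : Type*} [NormedAddCommGroup E] [NormedSpace ℝ E]
    {γ : ℝ} {r : S → A → ℝ} {p : S → A → S → ℝ} {π : E → S → A → ℝ} {g : S → A → E →L[ℝ] ℝ} {x : E}
    (hg : ∀ s a, HasFDerivAt (fun y => π y s a) (g s a) x) (n : ℕ) (s : S) :
    HasFDerivAt (fun y => valAux γ r p (π y) n s) (valAuxDeriv γ r p (π x) g n s) x := by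
  induction n generalizing s with
  | zero => exact hasFDerivAt_const _ _
  | succ n ih =>
    exact HasFDerivAt.fun_sum fun a _ => (hg s a).mul
      (((HasFDerivAt.fun_sum fun s' _ => (ih s').const_mul (p s a s')).const_mul γ).const_add
        (r s a))

theorem sum_stateMarginal_smul_valAuxDeriv {M : Type*} [AddCommGroup M] [Module ℝ M]
    (γ : ℝ) (r : S → A → ℝ) (p : S → A → S → ℝ) (μ : S → ℝ) (q : S → A → ℝ) (g : S → A → M)
    (n t : ℕ) :
    ∑ s, stateMarginal p μ q t s • valAuxDeriv γ r p q g n s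
      = ∑ k ∈ range n, γ ^ k • ∑ s, stateMarginal p μ q (t + k) s •
          ∑ a, Qval γ r p q n k s a • g s a := by
  induction n generalizing t with
  | zero => simp [valAuxDeriv]
  | succ n ih =>
    have hQ (k : ℕ) (s : S) (a : A) : Qval γ r p q (n + 1) (k + 1) s a = Qval γ r p q n k s a := by
      simp only [Qval, Vval, Nat.add_sub_add_right]
    have hnext : ∑ s, stateMarginal p μ q t s • ∑ a, q s a • γ •
          ∑ s', p s a s' • valAuxDeriv γ r p q g n s'
        = γ • ∑ s, stateMarginal p μ q (t + 1) s • valAuxDeriv γ r p q g n s := by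
      simp only [stateMarginal, smul_sum, sum_smul, mul_sum, smul_smul]
      refine Eq.trans ?_ sum_comm
      refine sum_congr rfl fun s' _ => ?_
      rw [sum_comm]
      refine sum_congr rfl fun s _ => sum_congr rfl fun a _ => ?_
      congr 1
      ring
    rw [sum_range_succ']
    simp only [valAuxDeriv, sum_add_distrib, smul_add]
    rw [hnext, ih, smul_sum]
    congr 1
    · refine sum_congr rfl fun k _ => ?_
      simp only [hQ, smul_smul, pow_succ', Nat.add_assoc, Nat.add_comm 1 k]
    · simp [Qval, Vval]

end PolicyGradient

section ScoreBound

variable {A E : Type*} [Fintype A] [NormedAddCommGroup E] [NormedSpace ℝ E]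

theorem sum_abs_sub_le_of_norm_fderiv_le {f : E → A → ℝ} {C : ℝ}
    (hf : ∀ a, Differentiable ℝ fun x => f x a) (hf1 : ∀ x, ∑ a, f x a = 1)
    (hC : ∀ x a, ‖fderiv ℝ (fun y => f y a) x‖ ≤ C * f x a) (x y : E) :
    ∑ a, |f x a - f y a| ≤ C * ‖x - y‖ := by
  let σ : A → ℝ := fun a => SignType.sign (f x a - f y a)
  have hσ (a : A) : |σ a| ≤ 1 := by
    simp only [σ]
    cases SignType.sign (f x a - f y a) <;> simp
  have hder (z : E) : HasFDerivAt (fun z => ∑ a, σ a * f z a)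
      (∑ a, σ a • fderiv ℝ (fun y => f y a) z) z :=
    HasFDerivAt.fun_sum fun a _ => ((hf a z).hasFDerivAt).const_mul (σ a)
  have hmv := convex_univ.norm_image_sub_le_of_norm_hasFDerivWithin_le
    (fun z _ => (hder z).hasFDerivWithinAt)
    (fun z _ => norm_sum_smul_le_of_norm_le_mul (hC z) (hf1 z) hσ) (Set.mem_univ y)
    (Set.mem_univ x)
  rw [mul_one] at hmv
  refine le_trans (Eq.trans_le ?_ (le_abs_self _)) hmv
  rw [← sum_sub_distrib]
  exact sum_congr rfl fun a _ => by rw [← mul_sub, sign_mul_self]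

theorem sum_mul_clipped_le {q q' : A → ℝ} (hq0' : ∀ a, 0 < q' a) {ε : ℝ} (hε : 0 < ε) :
    ∑ a, q a * (1 - if |q a / q' a - 1| ≤ ε then (1 : ℝ) else 0)
      ≤ (1 + 1 / ε) * ∑ a, |q a - q' a| := by
  rw [mul_sum]
  refine sum_le_sum fun a _ => ?_
  split_ifs with h
  · simp only [sub_self, mul_zero]; positivity
  · have e : q a / q' a - 1 = (q a - q' a) / q' a := by field_simp [(hq0' a).ne']
    rw [not_le, e, abs_div, abs_of_pos (hq0' a), lt_div_iff₀ (hq0' a)] at h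
    have h2 : q' a ≤ 1 / ε * |q a - q' a| := by
      rw [one_div, ← div_eq_inv_mul, le_div_iff₀ hε]; linarith
    have h3 := le_abs_self (q a - q' a)
    linarith

end ScoreBound

section SurrogateBias

variable {S A : Type*} [Fintype S] [Fintype A]

theorem norm_policyGradient_sub_clipped_le {M : Type*} [SeminormedAddCommGroup M] [NormedSpace ℝ M]
    {γ Rs : ℝ} {r : S → A → ℝ} {p : S → A → S → ℝ} {μ : S → ℝ} {q q' : S → A → ℝ}
    (hγ0 : 0 ≤ γ) (hγ1 : γ < 1) (hRs : 0 ≤ Rs) (hr : ∀ s a, |r s a| ≤ Rs)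
    (hp0 : ∀ s a s', 0 ≤ p s a s') (hp1 : ∀ s a, ∑ s', p s a s' = 1)
    (hμ0 : ∀ s, 0 ≤ μ s) (hμ1 : ∑ s, μ s = 1)
    (hq0 : ∀ s a, 0 ≤ q s a) (hq1 : ∀ s, ∑ a, q s a = 1)
    (hq0' : ∀ s a, 0 < q' s a) (hq1' : ∀ s, ∑ a, q' s a = 1) {D : ℝ} (hD0 : 0 ≤ D)
    (hD : ∀ s, ∑ a, |q s a - q' s a| ≤ D) {g : S → A → M} {G : ℝ} (hG0 : 0 ≤ G)
    (hG : ∀ s a, ‖g s a‖ ≤ G * q s a) (hg : ∀ s, ∑ a, g s a = 0) {ε : ℝ} (hε : 0 < ε) (T t : ℕ) :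
    ‖∑ s, stateMarginal p μ q t s • ∑ a, Qval γ r p q T t s a • g s a
        - ∑ s, stateMarginal p μ q' t s • ∑ a,
          ((if |q s a / q' s a - 1| ≤ ε then (1 : ℝ) else 0) * Adv γ r p q' T t s a) • g s a‖
      ≤ t * D * (G * (Rs / (1 - γ))) + (G * (γ * (D * Rs / (1 - γ) ^ 2))
          + 2 * (Rs / (1 - γ)) * G * ((1 + 1 / ε) * D)) := by
  have hq0'' s a := (hq0' s a).le
  have h1 : 0 < 1 - γ := sub_pos.2 hγ1
  let χ : S → A → ℝ := fun s a => if |q s a / q' s a - 1| ≤ ε then 1 else 0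
  have hχ (s : S) (a : A) : 0 ≤ 1 - χ s a := by simp only [χ]; split_ifs <;> simp
  have inner (s : S) : ∑ a, Qval γ r p q T t s a • g s a
      - ∑ a, (χ s a * Adv γ r p q' T t s a) • g s a
      = ∑ a, (Qval γ r p q T t s a - Qval γ r p q' T t s a) • g s a
        + ∑ a, ((1 - χ s a) * Adv γ r p q' T t s a) • g s a := by
    have hV : ∑ a, Vval γ r p q' T t s • g s a = 0 := by rw [← smul_sum, hg, smul_zero]
    rw [← add_zero (_ + _), ← hV, ← sum_sub_distrib, ← sum_add_distrib, ← sum_add_distrib]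
    refine sum_congr rfl fun a _ => ?_
    simp only [Adv]
    module
  have split : ∑ s, stateMarginal p μ q t s • ∑ a, Qval γ r p q T t s a • g s a
      - ∑ s, stateMarginal p μ q' t s • ∑ a, (χ s a * Adv γ r p q' T t s a) • g s a
      = ∑ s, (stateMarginal p μ q t s - stateMarginal p μ q' t s) •
          ∑ a, Qval γ r p q T t s a • g s a
        + ∑ s, stateMarginal p μ q' t s •
          (∑ a, (Qval γ r p q T t s a - Qval γ r p q' T t s a) • g s a
            + ∑ a, ((1 - χ s a) * Adv γ r p q' T t s a) • g s a) := by
    simp only [← inner]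
    rw [← sum_sub_distrib, ← sum_add_distrib]
    exact sum_congr rfl fun s _ => by module
  have clip (s : S) : ‖∑ a, ((1 - χ s a) * Adv γ r p q' T t s a) • g s a‖
      ≤ 2 * (Rs / (1 - γ)) * G * ((1 + 1 / ε) * D) := by
    have hsum : ∑ a, q s a * (1 - χ s a) ≤ (1 + 1 / ε) * D :=
      (sum_mul_clipped_le (hq0' s) hε).trans (mul_le_mul_of_nonneg_left (hD s) (by positivity))
    refine le_trans ?_ (mul_le_mul_of_nonneg_left hsum
      (show 0 ≤ 2 * (Rs / (1 - γ)) * G by positivity))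
    rw [mul_sum]
    refine norm_sum_le_of_le _ fun a _ => ?_
    rw [norm_smul, Real.norm_eq_abs, abs_mul, abs_of_nonneg (hχ s a)]
    calc (1 - χ s a) * |Adv γ r p q' T t s a| * ‖g s a‖
        ≤ (1 - χ s a) * (2 * (Rs / (1 - γ))) * (G * q s a) := by
          have hA := abs_Adv_le hγ0 hγ1 hRs hr hp0 hp1 hq0'' hq1' T t s a
          have hc := hχ s a
          have hgs := hG s a
          gcongr
      _ = 2 * (Rs / (1 - γ)) * G * (q s a * (1 - χ s a)) := by ring
  change ‖_ - ∑ s, stateMarginal p μ q' t s • ∑ a, (χ s a * Adv γ r p q' T t s a) • g s a‖ ≤ _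
  rw [split]
  refine (norm_add_le _ _).trans (add_le_add ?_ ?_)
  · refine (norm_sum_smul_le_sum_abs_mul fun s => norm_sum_smul_le_of_norm_le_mul (hG s) (hq1 s)
      (abs_Qval_le hγ0 hγ1 hRs hr hp0 hp1 hq0 hq1 T t s)).trans ?_
    exact mul_le_mul_of_nonneg_right
      (sum_abs_stateMarginal_sub_le hp0 hp1 hμ0 hμ1 hq0 hq1 hq0'' hq1' hD t) (by positivity)
  · refine (norm_sum_smul_le_sum_abs_mul fun s => (norm_add_le _ _).trans
      (add_le_add (norm_sum_smul_le_of_norm_le_mul (hG s) (hq1 s)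
        (abs_Qval_sub_le hγ0 hγ1 hRs hr hp0 hp1 hq0 hq1 hq0'' hq1' hD0 hD T t s)) (clip s))).trans_eq
      ?_
    simp only [abs_of_nonneg (stateMarginal_nonneg hp0 hμ0 hq0'' t _),
      sum_stateMarginal hp1 hμ1 hq1' t, one_mul]

theorem pow_mul_bias_le {γ Rs G δ ε : ℝ} (hγ0 : 0 ≤ γ) (hγ1 : γ < 1) (hRs : 0 ≤ Rs) (hδ : 0 ≤ δ)
    (hε : 0 < ε) (t : ℕ) :
    γ ^ t * (t * (G * δ) * (G * (Rs / (1 - γ))) + (G * (γ * (G * δ * Rs / (1 - γ) ^ 2))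
        + 2 * (Rs / (1 - γ)) * G * ((1 + 1 / ε) * (G * δ))))
      ≤ G ^ 2 * Rs * (8 * γ / (1 - γ) ^ 3 + 2 / (1 - γ) * (1 + 1 / ε)) * δ := by
  have h1 : 0 < 1 - γ := sub_pos.2 hγ1
  have hpow : γ ^ t ≤ 1 := pow_le_one₀ hγ0 hγ1.le
  have ht := natCast_mul_pow_le_div_one_sub hγ0 hγ1 t
  have hcube : γ / (1 - γ) ^ 2 ≤ γ / (1 - γ) ^ 3 :=
    div_le_div_of_nonneg_left hγ0 (by positivity)
      (pow_le_pow_of_le_one h1.le (by linarith) (by norm_num))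
  have hcube0 : 0 ≤ γ / (1 - γ) ^ 3 := by positivity
  calc _ = G ^ 2 * Rs * (t * γ ^ t * (1 / (1 - γ))
          + γ ^ t * (γ / (1 - γ) ^ 2 + 2 / (1 - γ) * (1 + 1 / ε))) * δ := by ring
    _ ≤ G ^ 2 * Rs * (γ / (1 - γ) * (1 / (1 - γ))
          + 1 * (γ / (1 - γ) ^ 2 + 2 / (1 - γ) * (1 + 1 / ε))) * δ := by gcongr
    _ = G ^ 2 * Rs * (2 * (γ / (1 - γ) ^ 2) + 2 / (1 - γ) * (1 + 1 / ε)) * δ := by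
        field_simp; ring
    _ ≤ G ^ 2 * Rs * (8 * γ / (1 - γ) ^ 3 + 2 / (1 - γ) * (1 + 1 / ε)) * δ := by
        rw [mul_div_assoc]
        gcongr
        linarith

section Gradient

variable {E : Type*} [NormedAddCommGroup E] [InnerProductSpace ℝ E] [CompleteSpace E]

theorem norm_gradient (f : E → ℝ) (x : E) : ‖gradient f x‖ = ‖fderiv ℝ f x‖ :=
  (InnerProductSpace.toDual ℝ E).symm.norm_map _

theorem sum_gradient_eq_zero {π : E → A → ℝ} {x : E}
    (hπ : ∀ a, DifferentiableAt ℝ (fun y => π y a) x) (hπ1 : ∀ y, ∑ a, π y a = 1) :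
    ∑ a, gradient (fun y => π y a) x = 0 := by
  simp only [gradient]
  rw [← map_sum, ← fderiv_fun_sum fun a _ => hπ a]
  simp [hπ1]

/-- The policy gradient theorem for the finite-horizon discounted objective. -/
theorem gradient_objective (γ : ℝ) (r : S → A → ℝ) (p : S → A → S → ℝ) (μ : S → ℝ) (T : ℕ)
    {π : E → S → A → ℝ} {x : E} (hπ : ∀ s a, DifferentiableAt ℝ (fun y => π y s a) x) :
    gradient (fun y => ∑ s, μ s * Vval γ r p (π y) T 0 s) x
      = ∑ t ∈ range T, γ ^ t • ∑ s, stateMarginal p μ (π x) t s •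
          ∑ a, Qval γ r p (π x) T t s a • gradient (fun y => π y s a) x := by
  have hJ : HasFDerivAt (fun y => ∑ s, μ s * Vval γ r p (π y) T 0 s)
      (∑ s, μ s • valAuxDeriv γ r p (π x) (fun s a => fderiv ℝ (fun y => π y s a) x) T s) x :=
    HasFDerivAt.fun_sum fun s _ =>
      (hasFDerivAt_valAux (fun s a => (hπ s a).hasFDerivAt) T s).const_mul (μ s)
  have hsum := sum_stateMarginal_smul_valAuxDeriv γ r p μ (π x)
    (fun s a => fderiv ℝ (fun y => π y s a) x) T 0
  simp only [stateMarginal, Nat.zero_add] at hsum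
  simp only [gradient]
  rw [hJ.fderiv, hsum]
  simp only [map_sum, map_smulₛₗ, conj_trivial]

end Gradient

end SurrogateBias

end

/-- **surrogate gradient bias bound, Theorem 1.** Coordinatewise,
`|∇J(θ) - g_PPO^clip(θ,θold)| ≤ R ⬝ ‖θ - θold‖` with
`R = Π_*² R_* (8Tγ/(1-γ)³ + (2T/(1-γ))(1 + 1/ε))`. -/
theorem surrogate_gradient_bias_control {S A : Type*} [Fintype S] [Fintype A]
    [Nonempty S] [Nonempty A] {d : ℕ}
    (γ : ℝ) (hγ0 : 0 < γ) (hγ1 : γ < 1)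
    (T : ℕ) (hT : 1 ≤ T)
    (Rs : ℝ) (r : S → A → ℝ) (hr : ∀ s a, |r s a| ≤ Rs)
    (p : S → A → S → ℝ) (hp0 : ∀ s a s', 0 ≤ p s a s') (hp1 : ∀ s a, ∑ s', p s a s' = 1)
    (μ : S → ℝ) (hμ0 : ∀ s, 0 ≤ μ s) (hμ1 : ∑ s, μ s = 1)
    (π : EuclideanSpace ℝ (Fin d) → S → A → ℝ)
    (hπpos : ∀ θ s a, 0 < π θ s a)
    (hπ1 : ∀ θ s, ∑ a, π θ s a = 1)
    (hπdiff : ∀ s a, ContDiff ℝ 1 fun θ => π θ s a)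
    (Pis : ℝ)
    (hscore : ∀ θ s a, ‖gradient (fun θ' => π θ' s a) θ‖ ≤ Pis * π θ s a)
    (ε : ℝ) (hε : 0 < ε)
    (θ θold : EuclideanSpace ℝ (Fin d)) :
    ∀ i : Fin d,
      |(gradient (fun θ'' => ∑ s, μ s * Vval γ r p (π θ'') T 0 s) θ
          - gPPOclip γ r p μ T ε π θ θold) i|
        ≤ (Pis ^ 2 * Rs * (8 * (T : ℝ) * γ / (1 - γ) ^ 3
              + (2 * (T : ℝ) / (1 - γ)) * (1 + 1 / ε))) * ‖θ - θold‖ := by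
  intro i
  have hdiff (s : S) (a : A) : Differentiable ℝ fun θ => π θ s a :=
    (hπdiff s a).differentiable one_ne_zero
  obtain ⟨s₀⟩ := ‹Nonempty S›
  obtain ⟨a₀⟩ := ‹Nonempty A›
  have hRs : 0 ≤ Rs := (abs_nonneg _).trans (hr s₀ a₀)
  have hPis : 0 ≤ Pis :=
    nonneg_of_mul_nonneg_left ((norm_nonneg _).trans (hscore θ s₀ a₀)) (hπpos θ s₀ a₀)
  have hD (s : S) : ∑ a, |π θ s a - π θold s a| ≤ Pis * ‖θ - θold‖ :=
    sum_abs_sub_le_of_norm_fderiv_le (hdiff s) (fun x => hπ1 x s)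
      (fun x a => (norm_gradient _ x).symm.trans_le (hscore x s a)) θ θold
  have hclip : gPPOclip γ r p μ T ε π θ θold
      = ∑ t ∈ Finset.range T, γ ^ t • ∑ s, stateMarginal p μ (π θold) t s • ∑ a,
          ((if |π θ s a / π θold s a - 1| ≤ ε then (1 : ℝ) else 0) *
            Adv γ r p (π θold) T t s a) • gradient (fun θ' => π θ' s a) θ := by
    simp only [gPPOclip, Finset.smul_sum, smul_smul, mul_assoc]
  rw [← Real.norm_eq_abs]
  refine (PiLp.norm_apply_le _ i).trans ?_
  rw [gradient_objective γ r p μ T fun s a => hdiff s a θ, hclip, ← Finset.sum_sub_distrib]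
  have hconst : Pis ^ 2 * Rs * (8 * (T : ℝ) * γ / (1 - γ) ^ 3 + (2 * (T : ℝ) / (1 - γ)) *
        (1 + 1 / ε)) * ‖θ - θold‖ = ∑ _t ∈ Finset.range T,
      Pis ^ 2 * Rs * (8 * γ / (1 - γ) ^ 3 + 2 / (1 - γ) * (1 + 1 / ε)) * ‖θ - θold‖ := by
    rw [Finset.sum_const, Finset.card_range, nsmul_eq_mul]
    ring
  rw [hconst]
  refine norm_sum_le_of_le _ fun t _ => ?_
  rw [← smul_sub, norm_smul, Real.norm_of_nonneg (pow_nonneg hγ0.le t)]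
  exact (mul_le_mul_of_nonneg_left
    (norm_policyGradient_sub_clipped_le hγ0.le hγ1 hRs hr hp0 hp1 hμ0 hμ1
      (fun s a => (hπpos θ s a).le) (hπ1 θ) (hπpos θold) (hπ1 θold)
      (mul_nonneg hPis (norm_nonneg _)) hD hPis (hscore θ)
      (fun s => sum_gradient_eq_zero (fun a => hdiff s a θ) fun x => hπ1 x s) hε T t)
    (pow_nonneg hγ0.le t)).trans (pow_mul_bias_le hγ0.le hγ1 hRs (norm_nonneg _) hε t)
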